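/- Let a > 0 and ε > 0 be real numbers and let n be a natural number with n > a. Then there exists a bounded set X ⊆ ℝⁿ whose Minkowski dimension exists, with |dim_M(X) − a| < ε; moreover, if a is rational one can choose X with dim_M(X) = a exactly. -/

import Mathlib

open Filter Metric Set

/-- The covering number of `A` by closed balls of radius `ε`. -/
noncomputable def coverNum {X : Type*} [MetricSpace X] (A : Set X) (ε : ℝ) : ℕ :=
  sInf {k | ∃ c : Fin k → X, A ⊆ ⋃ i, Metric.closedBall (c i) ε}


lemma cover_nonempty_le {X : Type*} [MetricSpace X] {A : Set X} {δ : ℝ} {ι : Type*} [Fintype ι]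
    (c : ι → X) (h : ∀ x ∈ A, ∃ i, dist x (c i) ≤ δ) :
    Fintype.card ι ∈ {k | ∃ c : Fin k → X, A ⊆ ⋃ i, Metric.closedBall (c i) δ} := by
  refine ⟨fun i => c ((Fintype.equivFin ι).symm i), fun x hx => ?_⟩
  obtain ⟨i, hi⟩ := h x hx
  refine Set.mem_iUnion.2 ⟨Fintype.equivFin ι i, ?_⟩
  simpa using hi

lemma card_le_coverNum {X : Type*} [MetricSpace X] {A : Set X} {δ : ℝ} {ι : Type*} [Fintype ι]
    (p : ι → X) (hp : ∀ i, p i ∈ A) (hsep : ∀ i j, i ≠ j → 2 * δ < dist (p i) (p j))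
    (hne : {k | ∃ c : Fin k → X, A ⊆ ⋃ i, Metric.closedBall (c i) δ}.Nonempty) :
    Fintype.card ι ≤ coverNum A δ := by
  obtain ⟨c, hc⟩ := Nat.sInf_mem hne
  have h : ∀ i, ∃ j, dist (p i) (c j) ≤ δ := fun i => by
    simpa using hc (hp i)
  choose g hg using h
  have hinj : Function.Injective g := by
    intro i j hij
    by_contra hne
    have h1 := hsep i j hne
    have h2 := hg i
    have h3 := hg j
    rw [← hij] at h3
    have := dist_triangle_right (p i) (p j) (c (g i))
    linarith
  simpa [coverNum] using Fintype.card_le_of_injective g hinj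

/-- The sequence `(k+1)^(-s)`. -/
noncomputable def seqPt (s : ℝ) (k : ℕ) : ℝ := ((k : ℝ) + 1) ^ (-s)

/-- The product set. -/
def prodSet (s : ℝ) (n : ℕ) : Set (EuclideanSpace ℝ (Fin n)) := {x | ∀ i, ∃ k, x i = seqPt s k}

lemma seqPt_pos (s : ℝ) (k : ℕ) : 0 < seqPt s k := by unfold seqPt; positivity

lemma seqPt_anti {s : ℝ} (hs : 0 < s) : Antitone (seqPt s) := by
  intro i j hij
  unfold seqPt
  apply Real.rpow_le_rpow_of_nonpos (by positivity) (by gcongr) (by linarith)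

lemma seqPt_le_one {s : ℝ} (hs : 0 < s) (k : ℕ) : seqPt s k ≤ 1 := by
  simpa [seqPt] using seqPt_anti hs (Nat.zero_le k)

lemma seqPt_gap {s : ℝ} (hs : 0 < s) (k : ℕ) :
    seqPt s (k + 1) + s * ((k : ℝ) + 2) ^ (-(s + 1)) ≤ seqPt s k := by
  unfold seqPt
  have hx : (0 : ℝ) < (k : ℝ) + 1 := by positivity
  have hy : (0 : ℝ) < (k : ℝ) + 2 := by positivity
  push_cast
  have e : (k : ℝ) + 1 + 1 = k + 2 := by ring
  rw [e]
  set x : ℝ := (k : ℝ) + 1 with hxd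
  set y : ℝ := (k : ℝ) + 2 with hyd
  have hyx : y = x + 1 := by rw [hxd, hyd]; ring
  have h1 : 1 + s / y ≤ (x / y) ^ (-s) := by
    rw [Real.rpow_def_of_pos (by positivity)]
    have h2 := Real.log_le_sub_one_of_pos (show 0 < x / y by positivity)
    have h3 := Real.add_one_le_exp (Real.log (x / y) * -s)
    have h4 : x / y - 1 = -(1 / y) := by field_simp; linarith
    rw [h4] at h2
    have h5 : s * Real.log (x / y) ≤ s * (-(1 / y)) := by gcongr
    have h6 : s * (-(1 / y)) = - (s / y) := by ring
    linarith
  have h7 : x ^ (-s) = (x / y) ^ (-s) * y ^ (-s) := by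
    rw [← Real.mul_rpow (by positivity) hy.le]; congr 1; field_simp
  have h8 : y ^ (-(s + 1)) = y ^ (-s) / y := by
    rw [neg_add, ← sub_eq_add_neg, Real.rpow_sub_one hy.ne']
  rw [h7, h8]
  have h9 : 0 < y ^ (-s) := by positivity
  calc y ^ (-s) + s * (y ^ (-s) / y) = (1 + s / y) * y ^ (-s) := by ring
    _ ≤ _ := by gcongr

lemma seqPt_sep {s : ℝ} (hs : 0 < s) {K i j : ℕ} (hij : i < j) (hj : j < K) :
    seqPt s j + s * (K : ℝ) ^ (-(s + 1)) ≤ seqPt s i := by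
  have h1 := seqPt_gap hs i
  have h2 := seqPt_anti hs (show i + 1 ≤ j from hij)
  have h3 : (K : ℝ) ^ (-(s + 1)) ≤ ((i : ℝ) + 2) ^ (-(s + 1)) := by
    apply Real.rpow_le_rpow_of_nonpos (by positivity) _ (by linarith)
    exact_mod_cast (by omega : i + 2 ≤ K)
  have h4 : s * (K : ℝ) ^ (-(s + 1)) ≤ s * ((i : ℝ) + 2) ^ (-(s + 1)) := by gcongr
  linarith

lemma coord_dist_le {n : ℕ} (x y : EuclideanSpace ℝ (Fin n)) (i : Fin n) :
    |x i - y i| ≤ dist x y := by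
  rw [dist_eq_norm]
  simpa using PiLp.norm_apply_le (x - y) i

lemma dist_le_of_coord {n : ℕ} (x y : EuclideanSpace ℝ (Fin n)) {η : ℝ} (hη : 0 ≤ η)
    (h : ∀ i, |x i - y i| ≤ η) : dist x y ≤ n * η := by
  rw [EuclideanSpace.dist_eq]
  apply Real.sqrt_le_iff.2 ⟨by positivity, ?_⟩
  calc ∑ i, dist (x i) (y i) ^ 2 ≤ ∑ i : Fin n, η ^ 2 := by
        apply Finset.sum_le_sum
        intro i _
        rw [Real.dist_eq]
        have := h i
        gcongr
    _ = n * η ^ 2 := by simp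
    _ ≤ (n * n) * η ^ 2 := by
        gcongr
        exact_mod_cast Nat.le_mul_self n
    _ = _ := by ring

/-- One-dimensional centres. -/
noncomputable def ctr (s : ℝ) (K : ℕ) : Fin K ⊕ Fin (K + 1) → ℝ
  | .inl k => seqPt s k
  | .inr m => (m : ℝ) * (K : ℝ) ^ (-(s + 1))

lemma ctr_cover {s : ℝ} (hs : 0 < s) {K : ℕ} (hK : 0 < K) (k : ℕ) :
    ∃ c, |seqPt s k - ctr s K c| ≤ (K : ℝ) ^ (-(s + 1)) := by
  have hK' : (0 : ℝ) < K := by exact_mod_cast hK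
  by_cases h : k < K
  · refine ⟨.inl ⟨k, h⟩, ?_⟩
    simp only [ctr, sub_self, abs_zero]
    positivity
  · set η : ℝ := (K : ℝ) ^ (-(s + 1)) with hη
    have hη0 : 0 < η := by positivity
    have h1 : seqPt s k ≤ K * η := by
      have : (K : ℝ) * η = (K : ℝ) ^ (-s) := by
        rw [hη, neg_add, ← sub_eq_add_neg, Real.rpow_sub_one hK'.ne']; field_simp
      rw [this]
      apply Real.rpow_le_rpow_of_nonpos hK' _ (by linarith)
      exact_mod_cast (by omega : K ≤ k + 1)
    have h2 : seqPt s k / η ≤ K := by rw [div_le_iff₀ hη0]; exact h1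
    have h0 : 0 ≤ seqPt s k / η := (div_pos (seqPt_pos s k) hη0).le
    have h3 : ⌊seqPt s k / η⌋₊ ≤ K := Nat.floor_le_of_le h2
    refine ⟨.inr ⟨⌊seqPt s k / η⌋₊, by omega⟩, ?_⟩
    simp only [ctr, ← hη]
    have h4 := Nat.floor_le h0
    have h5 := Nat.lt_floor_add_one (seqPt s k / η)
    rw [le_div_iff₀ hη0] at h4
    rw [div_lt_iff₀ hη0] at h5
    rw [abs_le]
    constructor <;> nlinarith

lemma prodSet_cover {s : ℝ} (hs : 0 < s) (n : ℕ) {K : ℕ} (hK : 0 < K) {δ : ℝ}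
    (h : n * (K : ℝ) ^ (-(s + 1)) ≤ δ) :
    (2 * K + 1) ^ n ∈ {k | ∃ c : Fin k → EuclideanSpace ℝ (Fin n),
      prodSet s n ⊆ ⋃ i, Metric.closedBall (c i) δ} := by
  have := cover_nonempty_le (A := prodSet s n) (δ := δ)
    (fun c : Fin n → Fin K ⊕ Fin (K + 1) => WithLp.toLp 2 (fun i => ctr s K (c i))) ?_
  · convert this using 1
    simp
    congr 1
    ring
  · intro x hx
    have h1 : ∀ i, ∃ c, |x i - ctr s K c| ≤ (K : ℝ) ^ (-(s + 1)) := by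
      intro i
      obtain ⟨k, hk⟩ := hx i
      rw [hk]
      exact ctr_cover hs hK k
    choose c hc using h1
    exact ⟨c, (dist_le_of_coord _ _ (by positivity) hc).trans h⟩

lemma prodSet_lower {s : ℝ} (hs : 0 < s) (n : ℕ) {K : ℕ} {δ : ℝ}
    (h : 2 * δ < s * (K : ℝ) ^ (-(s + 1)))
    (hne : {k | ∃ c : Fin k → EuclideanSpace ℝ (Fin n),
      prodSet s n ⊆ ⋃ i, Metric.closedBall (c i) δ}.Nonempty) :
    K ^ n ≤ coverNum (prodSet s n) δ := by
  have := card_le_coverNum (A := prodSet s n) (δ := δ)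
    (fun c : Fin n → Fin K => WithLp.toLp 2 (fun i => seqPt s (c i))) (fun c i => ⟨c i, rfl⟩) ?_ hne
  · simpa using this
  · intro c d hcd
    obtain ⟨i, hi⟩ := Function.ne_iff.1 hcd
    refine lt_of_lt_of_le ?_ (coord_dist_le _ _ i)
    refine h.trans_le ?_
    rcases lt_or_gt_of_ne hi with hlt | hlt
    · have := seqPt_sep hs (show (c i : ℕ) < d i from hlt) (d i).2
      exact le_trans (by simp only []; linarith) (le_abs_self _)
    · have := seqPt_sep hs (show (d i : ℕ) < c i from hlt) (c i).2
      exact le_trans (by simp only []; linarith) (neg_le_abs _)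

lemma tendsto_of_bounds {N : ℝ → ℝ} {a c C : ℝ} (hc : 0 < c) (hC : 0 < C)
    (h : ∀ᶠ δ in nhdsWithin (0 : ℝ) (Set.Ioi 0), c * (1 / δ) ^ a ≤ N δ ∧ N δ ≤ C * (1 / δ) ^ a) :
    Tendsto (fun δ => Real.log (N δ) / Real.log (1 / δ)) (nhdsWithin 0 (Set.Ioi 0)) (nhds a) := by
  have hL : Tendsto (fun δ : ℝ => Real.log (1 / δ)) (nhdsWithin 0 (Set.Ioi 0)) atTop := by
    simp only [one_div]
    exact Real.tendsto_log_atTop.comp tendsto_inv_nhdsGT_zero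
  have key : ∀ b : ℝ, Tendsto (fun δ : ℝ => b / Real.log (1 / δ) + a)
      (nhdsWithin 0 (Set.Ioi 0)) (nhds a) := by
    intro b
    simpa using (hL.const_div_atTop b).add_const a
  refine tendsto_of_tendsto_of_tendsto_of_le_of_le' (key (Real.log c)) (key (Real.log C)) ?_ ?_
  · filter_upwards [h, hL.eventually_gt_atTop 0, self_mem_nhdsWithin] with δ h1 h2 h3
    have h3 : 0 < δ := h3
    have hp : 0 < (1 / δ) ^ a := by positivity
    have := Real.log_le_log (by positivity) h1.1
    rw [Real.log_mul hc.ne' hp.ne', Real.log_rpow (by positivity)] at this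
    rw [div_add' _ _ _ h2.ne']
    gcongr
  · filter_upwards [h, hL.eventually_gt_atTop 0, self_mem_nhdsWithin] with δ h1 h2 h3
    have h3 : 0 < δ := h3
    have hp : 0 < (1 / δ) ^ a := by positivity
    have := Real.log_le_log (lt_of_lt_of_le (by positivity) h1.1) h1.2
    rw [Real.log_mul hC.ne' hp.ne', Real.log_rpow (by positivity)] at this
    rw [div_add' _ _ _ h2.ne']
    gcongr

lemma pow_root {b δ t a : ℝ} {n : ℕ} (hb : 0 < b) (hδ : 0 < δ) (hat : t⁻¹ * n = a) :
    ((b / δ) ^ t⁻¹) ^ n = b ^ a * (1 / δ) ^ a := by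
  rw [← Real.rpow_natCast, ← Real.rpow_mul (by positivity), hat,
    ← Real.mul_rpow hb.le (by positivity)]
  congr 1; ring

lemma root_neg {b δ t : ℝ} (hb : 0 < b) (hδ : 0 < δ) (ht : t ≠ 0) :
    ((b / δ) ^ t⁻¹) ^ (-t) = δ / b := by
  rw [← Real.rpow_mul (by positivity)]
  have : t⁻¹ * -t = -1 := by field_simp
  rw [this, Real.rpow_neg_one, inv_div]

lemma exists_exact (a : ℝ) (ha : 0 < a) (n : ℕ) (hn : a < n) :
    ∃ X : Set (EuclideanSpace ℝ (Fin n)), Bornology.IsBounded X ∧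
        Filter.Tendsto (fun δ : ℝ => Real.log (coverNum X δ) / Real.log (1 / δ))
          (nhdsWithin 0 (Set.Ioi 0)) (nhds a) := by
  have hn0 : (0 : ℝ) < n := ha.trans hn
  obtain ⟨s, hsd⟩ : ∃ s : ℝ, s = n / a - 1 := ⟨_, rfl⟩
  have hs : 0 < s := by
    rw [hsd, sub_pos, lt_div_iff₀ ha]; linarith
  have ht : (s + 1)⁻¹ * n = a := by
    rw [hsd, sub_add_cancel, inv_div]; field_simp
  have ht0 : 0 < s + 1 := by linarith
  refine ⟨prodSet s n, ?_, ?_⟩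
  · refine (Metric.isBounded_closedBall (x := (0 : EuclideanSpace ℝ (Fin n))) (r := n * 1)).subset ?_
    intro x hx
    refine Metric.mem_closedBall.2 (dist_le_of_coord _ _ zero_le_one fun i => ?_)
    obtain ⟨k, hk⟩ := hx i
    rw [hk]
    simpa [abs_of_pos (seqPt_pos s k)] using seqPt_le_one hs k
  · refine tendsto_of_bounds (N := fun δ => (coverNum (prodSet s n) δ : ℝ))
      (c := (1 / 2) ^ n * (s / 4) ^ a) (C := 5 ^ n * (n : ℝ) ^ a) (by positivity) (by positivity) ?_
    have hev : ∀ᶠ δ in nhdsWithin (0 : ℝ) (Set.Ioi 0), δ < min (n : ℝ) (s / 4) :=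
      (eventually_lt_nhds (by positivity : (0 : ℝ) < min (n : ℝ) (s / 4))).filter_mono
        nhdsWithin_le_nhds
    filter_upwards [hev, self_mem_nhdsWithin] with δ h1 h2
    have hδ : 0 < δ := h2
    obtain ⟨hδn, hδs⟩ := lt_min_iff.1 h1
    -- upper bound
    obtain ⟨r, hr⟩ : ∃ r : ℝ, r = ((n : ℝ) / δ) ^ (s + 1)⁻¹ := ⟨_, rfl⟩
    obtain ⟨q, hq⟩ : ∃ q : ℝ, q = ((s / 4) / δ) ^ (s + 1)⁻¹ := ⟨_, rfl⟩
    have hr1 : 1 ≤ r := by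
      rw [hr]; exact Real.one_le_rpow ((one_le_div hδ).2 hδn.le) (by positivity)
    have hq1 : 1 ≤ q := by
      rw [hq]; exact Real.one_le_rpow ((one_le_div hδ).2 hδs.le) (by positivity)
    have hrn : r ^ n = (n : ℝ) ^ a * (1 / δ) ^ a := by rw [hr]; exact pow_root hn0 hδ ht
    have hqn : q ^ n = (s / 4) ^ a * (1 / δ) ^ a := by
      rw [hq]; exact pow_root (by positivity) hδ ht
    have hrt : r ^ (-(s + 1)) = δ / n := by rw [hr]; exact root_neg hn0 hδ ht0.ne'
    have hqt : q ^ (-(s + 1)) = δ / (s / 4) := by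
      rw [hq]; exact root_neg (by positivity) hδ ht0.ne'
    have hcov := prodSet_cover hs n (K := ⌈r⌉₊) (Nat.ceil_pos.2 (by linarith)) (δ := δ) (by
      have : ((⌈r⌉₊ : ℕ) : ℝ) ^ (-(s + 1)) ≤ r ^ (-(s + 1)) :=
        Real.rpow_le_rpow_of_nonpos (by linarith) (Nat.le_ceil r) (by linarith)
      rw [hrt, le_div_iff₀ hn0] at this
      linarith)
    constructor
    · have hfl : 0 < ⌊q⌋₊ := Nat.floor_pos.2 hq1
      have hlow := prodSet_lower hs n (K := ⌊q⌋₊) (δ := δ) (by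
        have : q ^ (-(s + 1)) ≤ ((⌊q⌋₊ : ℕ) : ℝ) ^ (-(s + 1)) :=
          Real.rpow_le_rpow_of_nonpos (by exact_mod_cast hfl) (Nat.floor_le (by linarith))
            (by linarith)
        rw [hqt, div_le_iff₀ (by positivity)] at this
        linarith) ⟨_, hcov⟩
      have h3 : q / 2 ≤ (⌊q⌋₊ : ℝ) := by
        have := Nat.lt_floor_add_one q
        have : (1 : ℝ) ≤ ⌊q⌋₊ := by exact_mod_cast hfl
        linarith
      calc _ = (q / 2) ^ n := by rw [div_eq_mul_one_div q, mul_pow, hqn]; ring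
        _ ≤ (⌊q⌋₊ : ℝ) ^ n := by gcongr
        _ ≤ _ := by exact_mod_cast hlow
    · have hup : coverNum (prodSet s n) δ ≤ (2 * ⌈r⌉₊ + 1) ^ n := Nat.sInf_le hcov
      have h3 : (2 * (⌈r⌉₊ : ℝ) + 1) ≤ 5 * r := by
        have := Nat.ceil_lt_add_one (show 0 ≤ r by linarith)
        linarith
      calc (coverNum (prodSet s n) δ : ℝ) ≤ (2 * (⌈r⌉₊ : ℝ) + 1) ^ n := by exact_mod_cast hup
        _ ≤ (5 * r) ^ n := by gcongr
        _ = _ := by rw [mul_pow, hrn]; ring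

/-- For any `a > 0`, `ε > 0` and natural number `n > a`, there is a bounded set
`X ⊆ ℝⁿ` whose Minkowski dimension exists and lies within `ε` of `a`; moreover,
if `a` is rational one can choose `X` whose Minkowski dimension equals `a`. -/
theorem exists_set_minkowskiDim_near (a ε : ℝ) (ha : 0 < a) (hε : 0 < ε)
    (n : ℕ) (hn : a < n) :
    (∃ X : Set (EuclideanSpace ℝ (Fin n)), Bornology.IsBounded X ∧
      ∃ D : ℝ,
        Filter.Tendsto (fun δ : ℝ => Real.log (coverNum X δ) / Real.log (1 / δ))
          (nhdsWithin 0 (Set.Ioi 0)) (nhds D) ∧ |D - a| < ε) ∧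
    ((∃ q : ℚ, (q : ℝ) = a) →
      ∃ X : Set (EuclideanSpace ℝ (Fin n)), Bornology.IsBounded X ∧
        Filter.Tendsto (fun δ : ℝ => Real.log (coverNum X δ) / Real.log (1 / δ))
          (nhdsWithin 0 (Set.Ioi 0)) (nhds a)) := by
  obtain ⟨X, hX, hT⟩ := exists_exact a ha n hn
  exact ⟨⟨X, hX, a, hT, by simpa using hε⟩, fun _ => ⟨X, hX, hT⟩⟩
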